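/- arXiv:1007.1489 — 6 statements merged into one kernel-verified Lean document; each statement's English description precedes it below -/
import Mathlib

section
/- Fix a prime p. Every finitely generated p-LERF group is weakly p-LERF; that is, if Γ is finitely generated and every finitely generated subgroup of Γ equals its pro-p closure, then for every subgroup Λ of infinite index in Γ the pro-p closure of Λ also has infinite index in Γ. -/
/-- A subgroup is open in the pro-`p` topology if it contains a normal subgroup of
finite `p`-power index. -/
def ProPOpen (p : ℕ) {Γ : Type*} [Group Γ] (H : Subgroup Γ) : Prop :=
  ∃ N : Subgroup Γ, N.Normal ∧ N ≤ H ∧ ∃ k : ℕ, N.index = p ^ k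

/-- The pro-`p` closure of a subgroup: the intersection of all pro-`p`-open
subgroups containing it. -/
def ProPClosure (p : ℕ) {Γ : Type*} [Group Γ] (Λ : Subgroup Γ) : Subgroup Γ :=
  ⨅ (H : Subgroup Γ) (_ : ProPOpen p H) (_ : Λ ≤ H), H

/-- A group is `p`-LERF if every finitely generated subgroup equals its pro-`p`
closure. -/
def PLERF (p : ℕ) (Γ : Type*) [Group Γ] : Prop :=
  ∀ H : Subgroup Γ, H.FG → ProPClosure p H = H

/-- A group is weakly `p`-LERF if the pro-`p` closure of every infinite-index
subgroup still has infinite index. -/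
def WeaklyPLERF (p : ℕ) (Γ : Type*) [Group Γ] : Prop :=
  ∀ Λ : Subgroup Γ, ¬Λ.FiniteIndex → ¬(ProPClosure p Λ).FiniteIndex

open scoped commutatorElement

def pFrattiniSet (p : ℕ) {Γ : Type*} [Group Γ] (N : Subgroup Γ) : Set Γ :=
  {z | (∃ x ∈ N, z = x ^ p) ∨ ∃ x ∈ N, ∃ y ∈ N, z = ⁅x, y⁆}

lemma inf_index_pow {p : ℕ} (hp : p.Prime) {Γ : Type*} [Group Γ] (N M : Subgroup Γ)
    (hN : N.Normal) (hn : ∃ k : ℕ, N.index = p ^ k) (hm : ∃ k : ℕ, M.index = p ^ k) :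
    ∃ k : ℕ, (N ⊓ M).index = p ^ k := by
  obtain ⟨a, ha⟩ := hn
  obtain ⟨b, hb⟩ := hm
  have h1 : N.relIndex M ∣ N.index := Subgroup.relIndex_dvd_index_of_normal N M
  rw [ha] at h1
  obtain ⟨c, -, hc⟩ := (Nat.dvd_prime_pow hp).1 h1
  refine ⟨c + b, ?_⟩
  rw [← Subgroup.relIndex_mul_index (inf_le_right : N ⊓ M ≤ M), Subgroup.inf_relIndex_right, hc, hb,
    pow_add]

lemma ProPOpen.inf {p : ℕ} (hp : p.Prime) {Γ : Type*} [Group Γ] {H K : Subgroup Γ}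
    (h : ProPOpen p H) (k : ProPOpen p K) : ProPOpen p (H ⊓ K) := by
  obtain ⟨N, hN, hNH, hn⟩ := h
  obtain ⟨M, hM, hMK, hm⟩ := k
  exact ⟨N ⊓ M, inferInstance, inf_le_inf hNH hMK, inf_index_pow hp N M hN hn hm⟩

lemma ProPClosure_le {p : ℕ} {Γ : Type*} [Group Γ] {Λ H : Subgroup Γ}
    (h : ProPOpen p H) (hl : Λ ≤ H) : ProPClosure p Λ ≤ H :=
  iInf_le_of_le H (iInf_le_of_le h (iInf_le _ hl))

lemma le_ProPClosure {p : ℕ} {Γ : Type*} [Group Γ] {Λ K : Subgroup Γ}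
    (h : ∀ H, ProPOpen p H → Λ ≤ H → K ≤ H) : K ≤ ProPClosure p Λ :=
  le_iInf fun H => le_iInf fun h1 => le_iInf fun h2 => h H h1 h2

lemma open_of_finiteIndex {p : ℕ} (hp : p.Prime) {Γ : Type*} [Group Γ] (Λ : Subgroup Γ)
    (hC : (ProPClosure p Λ).FiniteIndex) : ProPOpen p (ProPClosure p Λ) := by
  classical
  let P : ℕ → Prop := fun n => ∃ H : Subgroup Γ, ProPOpen p H ∧ Λ ≤ H ∧ H.index = n
  have hb : ∀ n, P n → n ≤ (ProPClosure p Λ).index := by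
    rintro n ⟨H, h1, h2, rfl⟩
    exact Nat.le_of_dvd (Nat.pos_of_ne_zero hC.index_ne_zero)
      (Subgroup.index_dvd_of_le (ProPClosure_le h1 h2))
  have h1 : P 1 := ⟨⊤, ⟨⊤, inferInstance, le_rfl, 0, by simp⟩, le_top, by simp⟩
  obtain ⟨H₀, ho, hle, hi⟩ := Nat.findGreatest_spec (P := P) (hb 1 h1) h1
  have key : H₀ ≤ ProPClosure p Λ := by
    apply le_ProPClosure
    intro H h1 h2
    have hop := ho.inf hp h1
    have hle2 : Λ ≤ H₀ ⊓ H := le_inf hle h2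
    have hP : P (H₀ ⊓ H).index := ⟨_, hop, hle2, rfl⟩
    have h3 := Nat.le_findGreatest (hb _ hP) hP
    rw [← hi] at h3
    have hfin : (H₀ ⊓ H).FiniteIndex := Subgroup.finiteIndex_of_le (ProPClosure_le hop hle2)
    have h4 := Subgroup.relIndex_mul_index (inf_le_left : H₀ ⊓ H ≤ H₀)
    have hpos : H₀.index ≠ 0 := by
      intro h0; rw [h0] at h4; exact hfin.index_ne_zero (by simpa using h4.symm)
    have h5 : (H₀ ⊓ H).relIndex H₀ = 1 := by
      have h6 : (H₀ ⊓ H).relIndex H₀ ≠ 0 := by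
        intro h0; rw [h0] at h4; exact hfin.index_ne_zero (by simpa using h4.symm)
      have : (H₀ ⊓ H).relIndex H₀ ≤ 1 := by
        by_contra hcon
        push Not at hcon
        have : 0 < H₀.index := Nat.pos_of_ne_zero hpos
        nlinarith
      omega
    exact (Subgroup.relIndex_eq_one.1 h5).trans inf_le_right
  obtain ⟨N, a, b, c⟩ := ho
  exact ⟨N, a, b.trans key, c⟩

/-- In a finite p-group, a subgroup containing generators modulo p-th powers and commutators
is everything. -/
lemma pgroup_top {p : ℕ} (hp : p.Prime) {Q : Type*} [Group Q] [Finite Q] (hQ : IsPGroup p Q)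
    (B F : Subgroup Q) (hF : ∀ K : Subgroup Q, (∀ x : Q, x ^ p ∈ K) → (∀ x y : Q, ⁅x, y⁆ ∈ K) → F ≤ K)
    (h : B ⊔ F = ⊤) : B = ⊤ := by
  haveI : Fact p.Prime := ⟨hp⟩
  rcases eq_top_or_exists_le_coatom B with h1 | ⟨K, hK, hBK⟩
  · exact h1
  exfalso
  haveI : Group.IsNilpotent Q := hQ.isNilpotent
  haveI hn : K.Normal := Subgroup.NormalizerCondition.normal_of_coatom K
    (Group.normalizerCondition_of_isNilpotent) hK
  haveI : IsSimpleGroup (Q ⧸ K) := by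
    haveI : Nontrivial (Q ⧸ K) := QuotientGroup.nontrivial_iff.2 hK.1
    refine ⟨fun L hL => ?_⟩
    have hle : K ≤ L.comap (QuotientGroup.mk' K) := by
      intro x hx
      have : (QuotientGroup.mk' K) x = 1 := (QuotientGroup.eq_one_iff x).2 hx
      rw [Subgroup.mem_comap, this]; exact L.one_mem
    have hs := QuotientGroup.mk'_surjective K
    rcases hle.eq_or_lt with h2 | h2
    · left
      rw [← Subgroup.map_comap_eq_self_of_surjective hs L, ← h2]
      simp
    · right
      rw [← Subgroup.map_comap_eq_self_of_surjective hs L, hK.2 _ h2,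
        Subgroup.map_top_of_surjective _ hs]
  have hcomm : ∀ a b : Q ⧸ K, a * b = b * a :=
    IsSimpleGroup.comm_iff_isSolvable.2 inferInstance
  letI : CommGroup (Q ⧸ K) := { (inferInstance : Group (Q ⧸ K)) with mul_comm := hcomm }
  have hprime : (Nat.card (Q ⧸ K)).Prime := IsSimpleGroup.prime_card
  have hcard : Nat.card (Q ⧸ K) = p := by
    obtain ⟨n, hn⟩ := IsPGroup.iff_card.1 (hQ.to_quotient K)
    rw [hn] at hprime ⊢
    have := (Nat.prime_dvd_prime_iff_eq hprime hp).1
    have hn1 : n = 1 := by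
      by_contra hne
      exact Nat.Prime.not_prime_pow' hne hprime
    simp [hn1]
  have hFK : F ≤ K := by
    apply hF
    · intro x
      rw [← QuotientGroup.eq_one_iff, QuotientGroup.mk_pow, ← hcard]
      exact pow_card_eq_one'
    · intro x y
      rw [← QuotientGroup.eq_one_iff]
      change ⁅(x : Q ⧸ K), (y : Q ⧸ K)⁆ = 1
      rw [commutatorElement_eq_one_iff_mul_comm]
      exact hcomm _ _
  exact hK.1 (top_le_iff.1 (h ▸ sup_le hBK hFK))

lemma pFrattini_normal (p : ℕ) {Γ : Type*} [Group Γ] (N : Subgroup Γ) (hN : N.Normal) :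
    (Subgroup.closure (pFrattiniSet p N)).Normal := by
  have : Group.conjugatesOfSet (pFrattiniSet p N) = pFrattiniSet p N := by
    apply Set.Subset.antisymm _ Group.subset_conjugatesOfSet
    intro z hz
    obtain ⟨a, ha, hc⟩ := Group.mem_conjugatesOfSet_iff.1 hz
    obtain ⟨c, rfl⟩ := isConj_iff.1 hc
    rcases ha with ⟨x, hx, rfl⟩ | ⟨x, hx, y, hy, rfl⟩
    · exact Or.inl ⟨c * x * c⁻¹, hN.conj_mem x hx c, by rw [conj_pow]⟩
    · exact Or.inr ⟨c * x * c⁻¹, hN.conj_mem x hx c, c * y * c⁻¹, hN.conj_mem y hy c, by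
        simp only [commutatorElement_def]; group⟩
  have h2 : Subgroup.normalClosure (pFrattiniSet p N) = Subgroup.closure (pFrattiniSet p N) := by
    rw [Subgroup.normalClosure, this]
  rw [← h2]
  infer_instance

lemma pFrattini_le (p : ℕ) {Γ : Type*} [Group Γ] (N : Subgroup Γ) :
    Subgroup.closure (pFrattiniSet p N) ≤ N := by
  rw [Subgroup.closure_le]
  rintro z (⟨x, hx, rfl⟩ | ⟨x, hx, y, hy, rfl⟩)
  · exact N.pow_mem hx p
  · exact N.mul_mem (N.mul_mem (N.mul_mem hx hy) (N.inv_mem hx)) (N.inv_mem hy)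

lemma pFrattini_index {p : ℕ} (hp : p.Prime) {Γ : Type*} [Group Γ] (N : Subgroup Γ)
    (hN : N.Normal) (hfg : N.FG) (hn : ∃ k : ℕ, N.index = p ^ k) :
    ∃ k : ℕ, (Subgroup.closure (pFrattiniSet p N)).index = p ^ k := by
  haveI : Fact p.Prime := ⟨hp⟩
  obtain ⟨a, ha⟩ := hn
  set F := Subgroup.closure (pFrattiniSet p N) with hF
  haveI : F.Normal := pFrattini_normal p N hN
  haveI : Group.FG N := (Group.fg_iff_subgroup_fg N).2 hfg
  let F' := F.subgroupOf N
  have hcomm : ∀ a b : N ⧸ F', a * b = b * a := by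
    intro a b
    induction a using QuotientGroup.induction_on with | _ x
    induction b using QuotientGroup.induction_on with | _ y
    rw [← commutatorElement_eq_one_iff_mul_comm]
    change ((⁅x, y⁆ : N) : N ⧸ F') = 1
    rw [QuotientGroup.eq_one_iff, Subgroup.mem_subgroupOf]
    exact Subgroup.subset_closure (Or.inr ⟨x, x.2, y, y.2, rfl⟩)
  have hpow : ∀ a : N ⧸ F', a ^ p = 1 := by
    intro a
    induction a using QuotientGroup.induction_on with | _ x
    rw [← QuotientGroup.mk_pow, QuotientGroup.eq_one_iff, Subgroup.mem_subgroupOf]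
    exact Subgroup.subset_closure (Or.inl ⟨x, x.2, rfl⟩)
  letI : CommGroup (N ⧸ F') := { (inferInstance : Group (N ⧸ F')) with mul_comm := hcomm }
  haveI : Group.FG (N ⧸ F') := QuotientGroup.fg F'
  haveI : Finite (N ⧸ F') := CommGroup.finite_of_fg_torsion _
    (fun x => isOfFinOrder_iff_pow_eq_one.2 ⟨p, hp.pos, hpow x⟩)
  have hpg : IsPGroup p (N ⧸ F') := fun x => ⟨1, by rw [pow_one]; exact hpow x⟩
  obtain ⟨b, hb⟩ := IsPGroup.iff_card.1 hpg
  refine ⟨b + a, ?_⟩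
  rw [← Subgroup.relIndex_mul_index (pFrattini_le p N), ha, pow_add]
  congr 1

lemma exists_fg_sup {Γ : Type*} [Group Γ] (Λ F : Subgroup Γ) (hF : F.Normal)
    (hfin : F.FiniteIndex) : ∃ L : Subgroup Γ, L.FG ∧ L ≤ Λ ∧ Λ ≤ L ⊔ F := by
  classical
  haveI : Finite (Γ ⧸ F) := inferInstance
  let S : Set (Γ ⧸ F) := QuotientGroup.mk '' (Λ : Set Γ)
  have hS : ∀ q : S, ∃ x : Γ, x ∈ Λ ∧ (x : Γ ⧸ F) = q := fun q => q.2
  choose f hf1 hf2 using hS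
  refine ⟨Subgroup.closure (Set.range f), ?_, ?_, ?_⟩
  · exact (Subgroup.fg_iff _).2 ⟨_, rfl, Set.finite_range f⟩
  · rw [Subgroup.closure_le]
    rintro _ ⟨q, rfl⟩
    exact hf1 q
  · intro x hx
    let q : S := ⟨(x : Γ ⧸ F), x, hx, rfl⟩
    have h1 : (f q : Γ ⧸ F) = (x : Γ ⧸ F) := hf2 q
    have h2 : (f q)⁻¹ * x ∈ F := QuotientGroup.eq.1 h1
    have : x = f q * ((f q)⁻¹ * x) := by group
    rw [this]
    exact Subgroup.mul_mem_sup (Subgroup.subset_closure ⟨q, rfl⟩) h2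

lemma dense_step {p : ℕ} (hp : p.Prime) {Γ : Type*} [Group Γ] (N : Subgroup Γ) (hN : N.Normal)
    (H : Subgroup Γ) (hH : ProPOpen p H)
    (h : N ≤ H ⊔ Subgroup.closure (pFrattiniSet p N)) : N ≤ H := by
  haveI : Fact p.Prime := ⟨hp⟩
  obtain ⟨M, hM, hMH, a, ha⟩ := hH
  have hFn := pFrattini_normal p N hN
  have hFN := pFrattini_le p N
  set F := Subgroup.closure (pFrattiniSet p N) with hF
  let M' := M.subgroupOf N
  have h1 : M.relIndex N ∣ M.index := Subgroup.relIndex_dvd_index_of_normal M N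
  rw [ha] at h1
  obtain ⟨c, -, hc⟩ := (Nat.dvd_prime_pow hp).1 h1
  have hcard : Nat.card (N ⧸ M') = p ^ c := hc
  haveI : Finite (N ⧸ M') := Nat.finite_of_card_ne_zero (by
    rw [hcard]; exact pow_ne_zero _ hp.ne_zero)
  have hpg : IsPGroup p (N ⧸ M') := IsPGroup.of_card hcard
  have hs := QuotientGroup.mk'_surjective M'
  have htop := pgroup_top hp hpg ((H.subgroupOf N).map (QuotientGroup.mk' M'))
    ((F.subgroupOf N).map (QuotientGroup.mk' M')) (by
      intro K h1 h2
      rw [Subgroup.map_le_iff_le_comap]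
      have : F ≤ (K.comap (QuotientGroup.mk' M')).map N.subtype := by
        rw [hF, Subgroup.closure_le]
        rintro z (⟨x, hx, rfl⟩ | ⟨x, hx, y, hy, rfl⟩)
        · exact ⟨(⟨x, hx⟩ : N) ^ p, h1 (QuotientGroup.mk' M' ⟨x, hx⟩), rfl⟩
        · exact ⟨⁅(⟨x, hx⟩ : N), (⟨y, hy⟩ : N)⁆, h2 (QuotientGroup.mk' M' ⟨x, hx⟩) (QuotientGroup.mk' M' ⟨y, hy⟩), rfl⟩
      intro x hx
      obtain ⟨y, hy, hyx⟩ := this (Subgroup.mem_subgroupOf.1 hx)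
      have : y = x := Subtype.ext hyx
      exact this ▸ hy) (by
      rw [← Subgroup.map_sup, ← Subgroup.map_top_of_surjective _ hs]
      congr 1
      rw [eq_top_iff]
      rintro ⟨x, hx⟩ -
      obtain ⟨y, hy, z, hz, hyz⟩ := Subgroup.mem_sup_of_normal_right.1 (h hx)
      have hyN : y ∈ N := by
        have : y = x * z⁻¹ := by rw [← hyz]; group
        rw [this]; exact N.mul_mem hx (N.inv_mem (hFN hz))
      have : (⟨x, hx⟩ : N) = ⟨y, hyN⟩ * ⟨z, hFN hz⟩ := Subtype.ext hyz.symm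
      rw [this]
      exact Subgroup.mul_mem_sup (Subgroup.mem_subgroupOf.2 hy) (Subgroup.mem_subgroupOf.2 hz))
  intro x hx
  have hm : (QuotientGroup.mk' M') ⟨x, hx⟩ ∈ (H.subgroupOf N).map (QuotientGroup.mk' M') := by
    rw [htop]; trivial
  obtain ⟨y, hy, hyx⟩ := hm
  have h3 : y⁻¹ * ⟨x, hx⟩ ∈ M' := QuotientGroup.eq.1 hyx
  have h4 : (y : Γ)⁻¹ * x ∈ M := h3
  have : x = y * ((y : Γ)⁻¹ * x) := by group
  rw [this]
  exact H.mul_mem hy (hMH h4)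

/-- Every finitely generated `p`-LERF group is weakly `p`-LERF. -/
theorem weaklyPLERF_of_pLERF (p : ℕ) (hp : p.Prime)
    (Γ : Type*) [Group Γ] (hfg : Group.FG Γ) (hl : PLERF p Γ) :
    WeaklyPLERF p Γ := by
  intro Λ hΛ hC
  apply hΛ
  obtain ⟨N, hN, hNC, hn⟩ := open_of_finiteIndex hp Λ hC
  have hNfi : N.FiniteIndex := ⟨by
    obtain ⟨k, hk⟩ := hn
    rw [hk]; exact pow_ne_zero _ hp.ne_zero⟩
  have hNfg : N.FG := (Group.fg_iff_subgroup_fg N).1 inferInstance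
  have hFi := pFrattini_index hp N hN hNfg hn
  have hFn := pFrattini_normal p N hN
  have hFN := pFrattini_le p N
  have hd := dense_step hp N hN
  generalize Subgroup.closure (pFrattiniSet p N) = F at *
  have hFfi : F.FiniteIndex := ⟨by
    obtain ⟨k, hk⟩ := hFi
    rw [hk]; exact pow_ne_zero _ hp.ne_zero⟩
  have hCle : ProPClosure p Λ ≤ Λ ⊔ F := ProPClosure_le ⟨F, hFn, le_sup_right, hFi⟩ le_sup_left
  obtain ⟨L, hLfg, hLΛ, hΛL⟩ := exists_fg_sup Λ F hFn hFfi
  have hCL : ProPClosure p Λ ≤ L ⊔ F := hCle.trans (sup_le hΛL le_sup_right)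
  have hfinal : ProPClosure p Λ ≤ L := by
    rw [← hl L hLfg]
    apply le_ProPClosure
    intro H hH hLH
    have hNH : N ≤ H := hd H hH (hNC.trans (hCL.trans (sup_le_sup_right hLH F)))
    exact hCL.trans (sup_le hLH (hFN.trans hNH))
  exact Subgroup.finiteIndex_of_le (hfinal.trans hLΛ)
end

section
/- Fix a prime p. Let Γ be a finitely generated infinite group which is weakly p-LERF. Then Γ has infinite pro-p completion; that is, for every n ∈ ℕ there exists a normal subgroup N of Γ whose index [Γ:N] is finite, a power of p, and greater than n. -/
/-- A finitely generated infinite weakly `p`-LERF group has infinite pro-`p`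
completion: it has normal subgroups of arbitrarily large finite `p`-power index. -/
theorem infinite_pro_p_completion_of_weaklyPLERF (p : ℕ) (hp : p.Prime)
    (Γ : Type*) [Group Γ] (hfg : Group.FG Γ) [Infinite Γ] (hw : WeaklyPLERF p Γ) :
    ∀ n : ℕ, ∃ N : Subgroup Γ, N.Normal ∧ ∃ k : ℕ, N.index = p ^ k ∧ n < N.index := by
  classical
  intro n
  by_contra hcon
  push Not at hcon
  have hP : ∃ m, ∃ N : Subgroup Γ, N.Normal ∧ (∃ k : ℕ, N.index = p ^ k) ∧ N.index = m :=
    ⟨1, ⊤, inferInstance, ⟨0, by simp⟩, by simp⟩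
  obtain ⟨m0, N0, hN0, hk0, hm0⟩ := hP
  have hb : ∀ m, (∃ N : Subgroup Γ, N.Normal ∧ (∃ k : ℕ, N.index = p ^ k) ∧ N.index = m) →
      m ≤ n := by
    rintro m ⟨N, hN, ⟨k, hk⟩, rfl⟩
    exact hcon N hN k hk
  obtain ⟨N, hN, ⟨k, hk⟩, hNm⟩ := Nat.findGreatest_spec
    (P := fun m => ∃ N : Subgroup Γ, N.Normal ∧ (∃ k : ℕ, N.index = p ^ k) ∧ N.index = m)
    (hb m0 ⟨N0, hN0, hk0, hm0⟩) ⟨N0, hN0, hk0, hm0⟩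
  have hmax : ∀ M : Subgroup Γ, M.Normal → (∃ k : ℕ, M.index = p ^ k) → M.index ≤ N.index := by
    intro M hM hkM
    rw [hNm]
    exact Nat.le_findGreatest (hb _ ⟨M, hM, hkM, rfl⟩) ⟨M, hM, hkM, rfl⟩
  have hle : ∀ M : Subgroup Γ, M.Normal → (∃ k : ℕ, M.index = p ^ k) → N ≤ M := by
    rintro M hM ⟨j, hj⟩
    have h1 : (M ⊓ N).relIndex N * N.index = (M ⊓ N).index :=
      Subgroup.relIndex_mul_index inf_le_right
    rw [Subgroup.inf_relIndex_right] at h1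
    have h2 : M.relIndex N ∣ p ^ j := hj ▸ Subgroup.relIndex_dvd_index_of_normal M N
    obtain ⟨i, -, hi⟩ := (Nat.dvd_prime_pow hp).1 h2
    have h3 := hmax (M ⊓ N) inferInstance ⟨i + k, by rw [← h1, hi, hk, pow_add]⟩
    rw [← h1] at h3
    have hpos : 0 < N.index := hk ▸ pow_pos hp.pos k
    have hpos' : 0 < M.relIndex N := hi ▸ pow_pos hp.pos i
    have h4 : M.relIndex N = 1 := by nlinarith
    exact Subgroup.relIndex_eq_one.1 h4
  have hNf : N.FiniteIndex := ⟨hk ▸ (pow_pos hp.pos k).ne'⟩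
  refine hw ⊥ ?_ ?_
  · intro h
    apply h.index_ne_zero
    rw [Subgroup.index_bot]
    exact Nat.card_eq_zero_of_infinite
  · refine Subgroup.finiteIndex_of_le (H := N) ?_
    refine le_iInf fun H => le_iInf fun hH => le_iInf fun _ => ?_
    obtain ⟨M, hM, hMH, hkM⟩ := hH
    exact (hle M hM hkM).trans hMH
end

section
/- Fix a prime p. Let Γ be a finitely generated p-LERF group and let N be a normal subgroup of Γ such that the quotient Γ/N is infinite. Then Γ/N has infinite pro-p completion; that is, for every n ∈ ℕ there exists a normal subgroup M of Γ/N whose index is finite, a power of p, and greater than n. -/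
def WFr (p : ℕ) (G : Type*) [Group G] : Subgroup G :=
  Subgroup.closure ({g | ∃ a b : G, a * b * a⁻¹ * b⁻¹ = g} ∪ {g | ∃ a : G, a ^ p = g})

lemma WFr_map_le (p : ℕ) {G H : Type*} [Group G] [Group H] (f : G →* H) :
    (WFr p G).map f ≤ WFr p H := by
  unfold WFr
  rw [MonoidHom.map_closure, Subgroup.closure_le]
  rintro _ ⟨x, (⟨a, b, rfl⟩ | ⟨a, rfl⟩), rfl⟩
  · exact Subgroup.subset_closure (Or.inl ⟨f a, f b, by simp⟩)
  · exact Subgroup.subset_closure (Or.inr ⟨f a, by simp⟩)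

instance WFr_char (p : ℕ) (G : Type*) [Group G] : (WFr p G).Characteristic :=
  Subgroup.characteristic_iff_map_le.mpr fun f => WFr_map_le p f.toMonoidHom

lemma WFr_index (p : ℕ) (hp : p.Prime) (G : Type*) [Group G] [Group.FG G] :
    ∃ k : ℕ, (WFr p G).index = p ^ k := by
  have : Fact p.Prime := ⟨hp⟩
  have hc : ∀ a b : G ⧸ WFr p G, a * b = b * a := by
    intro a b
    obtain ⟨a, rfl⟩ := QuotientGroup.mk_surjective a
    obtain ⟨b, rfl⟩ := QuotientGroup.mk_surjective b
    rw [← commutatorElement_eq_one_iff_mul_comm, commutatorElement_def]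
    exact (QuotientGroup.eq_one_iff (a * b * a⁻¹ * b⁻¹)).mpr (Subgroup.subset_closure (Or.inl ⟨a, b, rfl⟩))
  have ht : ∀ a : G ⧸ WFr p G, a ^ p = 1 := by
    intro a
    obtain ⟨a, rfl⟩ := QuotientGroup.mk_surjective a
    exact (QuotientGroup.eq_one_iff (a ^ p)).mpr (Subgroup.subset_closure (Or.inr ⟨a, rfl⟩))
  let : CommGroup (G ⧸ WFr p G) := { (inferInstance : Group (G ⧸ WFr p G)) with mul_comm := hc }
  have : Group.FG (G ⧸ WFr p G) := QuotientGroup.fg _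
  have : Finite (G ⧸ WFr p G) := by
    apply CommGroup.finite_of_fg_isMulTorsion
    exact fun a => isOfFinOrder_iff_pow_eq_one.mpr ⟨p, hp.pos, ht a⟩
  have : IsPGroup p (G ⧸ WFr p G) := isPGroup_iff_pow_pow_eq_one.mpr fun a => ⟨1, by simpa using ht a⟩
  exact IsPGroup.iff_card.mp this

lemma WFr_le_frattini (p : ℕ) [hp : Fact p.Prime] (Q : Type*) [Group Q] [Finite Q]
    (hQ : IsPGroup p Q) : WFr p Q ≤ frattini Q := by
  have := hQ.isNilpotent
  refine le_iInf₂ fun C hC => ?_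
  have : C.Normal := Subgroup.NormalizerCondition.normal_of_coatom C Group.normalizerCondition_of_isNilpotent hC
  have hQC := hQ.to_quotient C
  have := hQC.isNilpotent
  have : Nontrivial (Q ⧸ C) := QuotientGroup.nontrivial_iff.mpr hC.1
  have : IsSimpleGroup (Q ⧸ C) := ⟨fun L hL => by
    have hle : C ≤ L.comap (QuotientGroup.mk' C) := by
      intro x hx
      rw [Subgroup.mem_comap, QuotientGroup.mk'_apply, (QuotientGroup.eq_one_iff x).mpr hx]
      exact L.one_mem
    have hm := Subgroup.map_comap_eq_self_of_surjective (QuotientGroup.mk'_surjective C) L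
    rcases hC.le_iff.mp hle with h | h
    · right
      rw [← hm, h, Subgroup.map_top_of_surjective _ (QuotientGroup.mk'_surjective C)]
    · left
      rw [← hm, h]
      simp⟩
  have hc := IsSimpleGroup.comm_iff_isSolvable.mpr (inferInstance : Group.IsSolvable (Q ⧸ C))
  have hcard : Nat.card (Q ⧸ C) = p := by
    let : CommGroup (Q ⧸ C) := { (inferInstance : Group (Q ⧸ C)) with mul_comm := hc }
    have h1 : (Nat.card (Q ⧸ C)).Prime := IsSimpleGroup.prime_card
    obtain ⟨n, hn⟩ := IsPGroup.iff_card.mp hQC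
    rw [hn] at h1
    have := Nat.Prime.eq_one_of_pow h1
    rw [hn, this, pow_one]
  unfold WFr
  rw [Subgroup.closure_le]
  rintro _ (⟨a, b, rfl⟩ | ⟨a, rfl⟩)
  · rw [SetLike.mem_coe, ← QuotientGroup.eq_one_iff]
    exact commutatorElement_eq_one_iff_mul_comm.mpr (hc (a : Q ⧸ C) b)
  · rw [SetLike.mem_coe, ← QuotientGroup.eq_one_iff, QuotientGroup.mk_pow]
    conv_lhs => rw [← hcard]
    exact pow_card_eq_one'

lemma eq_top_of_sup_WFr (p : ℕ) [hp : Fact p.Prime] (G : Type*) [Group G]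
    (L K : Subgroup G) [K.Normal] (hKL : K ≤ L) (k : ℕ) (hk : K.index ∣ p ^ k)
    (h : L ⊔ WFr p G = ⊤) : L = ⊤ := by
  have h0 : K.index ≠ 0 := fun h => by
    rw [h, zero_dvd_iff] at hk
    exact (pow_pos hp.out.pos k).ne' hk
  have : K.FiniteIndex := ⟨h0⟩
  have hQ : IsPGroup p (G ⧸ K) := IsPGroup.of_card_dvd_pow hk
  have hs := QuotientGroup.mk'_surjective K
  have h1 : L.map (QuotientGroup.mk' K) ⊔ frattini (G ⧸ K) = ⊤ := by
    rw [eq_top_iff, ← Subgroup.map_top_of_surjective _ hs, ← h, Subgroup.map_sup]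
    exact sup_le_sup_left ((WFr_map_le p _).trans (WFr_le_frattini p _ hQ)) _
  have h2 := frattini_nongenerating h1
  have h3 := Subgroup.comap_map_eq_self (f := QuotientGroup.mk' K) (H := L) (by simpa using hKL)
  rw [← h3, h2, Subgroup.comap_top]

/-- Every infinite quotient of a finitely generated `p`-LERF group has infinite
pro-`p` completion. -/
theorem infinite_pro_p_completion_of_quotient_of_pLERF (p : ℕ) (hp : p.Prime)
    (Γ : Type*) [Group Γ] (hfg : Group.FG Γ) (hl : PLERF p Γ)
    (N : Subgroup Γ) [N.Normal] (hinf : Infinite (Γ ⧸ N)) :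
    ∀ n : ℕ, ∃ M : Subgroup (Γ ⧸ N), M.Normal ∧ ∃ k : ℕ, M.index = p ^ k ∧ n < M.index := by
  have : Fact p.Prime := ⟨hp⟩
  by_contra! hcon
  obtain ⟨n, hn⟩ := hcon
  -- the normal subgroup of maximal index
  let S : Set ℕ := {i | ∃ M : Subgroup (Γ ⧸ N), M.Normal ∧ M.index = i ∧ ∃ k, i = p ^ k}
  have hSb : BddAbove S := ⟨n, by
    rintro _ ⟨M, hM, rfl, k, hk⟩
    exact hn M hM k hk⟩
  have hSn : S.Nonempty := ⟨1, ⊤, inferInstance, Subgroup.index_top, 0, by simp⟩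
  obtain ⟨M, hMn, hMi, k, hk⟩ := Nat.sSup_mem hSn hSb
  have hsurj := QuotientGroup.mk'_surjective N
  let A : Subgroup Γ := M.comap (QuotientGroup.mk' N)
  have hAi : A.index = p ^ k := by
    rw [Subgroup.index_comap_of_surjective _ hsurj, hMi, hk]
  have hAfin : A.FiniteIndex := ⟨by rw [hAi]; exact (pow_pos hp.pos k).ne'⟩
  have hNA : N ≤ A := by
    intro x hx
    rw [Subgroup.mem_comap, QuotientGroup.mk'_apply, (QuotientGroup.eq_one_iff x).mpr hx]
    exact M.one_mem
  obtain ⟨j, hj⟩ := WFr_index p hp A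
  let W : Subgroup Γ := (WFr p A).map A.subtype
  have hWi : W.index = p ^ (j + k) := by
    rw [Subgroup.index_map_subtype, hj, hAi, pow_add]
  have hWA : W ≤ A := Subgroup.map_subtype_le _
  have hKn : (W.map (QuotientGroup.mk' N)).Normal :=
    Subgroup.Normal.map (inferInstanceAs ((WFr p A).map A.subtype).Normal) _ hsurj
  have hKd := Subgroup.index_map_dvd W hsurj
  rw [hWi, Nat.dvd_prime_pow hp] at hKd
  obtain ⟨l, -, hl'⟩ := hKd
  have hKM : W.map (QuotientGroup.mk' N) ≤ M := Subgroup.map_le_iff_le_comap.mpr hWA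
  have hKeq : W.map (QuotientGroup.mk' N) = M := by
    by_contra hne
    have : (W.map (QuotientGroup.mk' N)).FiniteIndex :=
      ⟨by rw [hl']; exact (pow_pos hp.pos l).ne'⟩
    have h1 := Subgroup.index_strictAnti (lt_of_le_of_ne hKM hne)
    have h2 := le_csSup hSb (show _ ∈ S from ⟨_, hKn, rfl, l, hl'⟩)
    omega
  -- every element of A is a product of an element of N and one of W
  have hdec : ∀ a : A, ∃ ν : A, (ν : Γ) ∈ N ∧ ν⁻¹ * a ∈ WFr p A := by
    intro a
    have : QuotientGroup.mk' N (a : Γ) ∈ W.map (QuotientGroup.mk' N) := by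
      rw [hKeq]; exact a.2
    obtain ⟨_, ⟨w, hw, rfl⟩, hwa⟩ := this
    refine ⟨a * w⁻¹, ?_, by simpa using hw⟩
    rw [← QuotientGroup.eq_one_iff]
    have : ((w : Γ) : Γ ⧸ N) = ((a : Γ) : Γ ⧸ N) := hwa
    simp [this]
  choose ν hνN hνW using hdec
  obtain ⟨T, hT⟩ := (Group.fg_def.mp (inferInstance : Group.FG A))
  classical
  let Λ : Subgroup A := Subgroup.closure (T.image ν : Set A)
  have hΛ : Λ ⊔ WFr p A = ⊤ := by
    rw [eq_top_iff, ← hT, Subgroup.closure_le]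
    intro t ht
    have h1 : ν t ∈ Λ := Subgroup.subset_closure (by rw [Finset.coe_image]; exact ⟨t, ht, rfl⟩)
    have := mul_mem ((le_sup_left : Λ ≤ Λ ⊔ WFr p A) h1) ((le_sup_right : _ ≤ Λ ⊔ WFr p A) (hνW t))
    simpa using this
  have hΛfg : (Λ.map A.subtype).FG := by
    refine ⟨(T.image ν).image A.subtype, ?_⟩
    rw [Finset.coe_image, ← MonoidHom.map_closure]
  have hΛN : Λ.map A.subtype ≤ N := by
    rw [Subgroup.map_le_iff_le_comap, Subgroup.closure_le]
    intro x hx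
    simp only [Finset.coe_image, Set.mem_image] at hx
    obtain ⟨t, -, rfl⟩ := hx
    exact hνN t
  have hcl : A ≤ ProPClosure p (Λ.map A.subtype) := by
    refine le_iInf fun H => le_iInf fun hH => le_iInf fun hΛH => ?_
    obtain ⟨K, hK, hKH, m, hm⟩ := hH
    rw [← Subgroup.subgroupOf_eq_top]
    refine eq_top_of_sup_WFr p A _ (K.subgroupOf A) (Subgroup.comap_mono hKH) m ?_ ?_
    · rw [← hm]
      exact Subgroup.relIndex_dvd_index_of_normal K A
    · rw [eq_top_iff, ← hΛ]
      exact sup_le_sup_right (Subgroup.map_le_iff_le_comap.mp hΛH) _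
  rw [hl _ hΛfg] at hcl
  have : N.FiniteIndex := Subgroup.finiteIndex_of_le (hcl.trans hΛN)
  exact not_finite (Γ ⧸ N)
end

section
/- Let G be a group, H a normal subgroup of G of finite index, k ≥ 2 an integer, and L_1, …, L_k subgroups of H, each normal in H, such that: every element of L_i commutes with every element of L_j whenever i ≠ j; the multiplication map L_1 × ⋯ × L_k → H, (x_1,…,x_k) ↦ x_1⋯x_k, is a group isomorphism; for every g ∈ G and every i ∈ {1,…,k} there exists j with g L_i g⁻¹ = L_j; and for all i, j ∈ {1,…,k} there exists g ∈ G with g L_i g⁻¹ = L_j (the conjugation action on {L_1,…,L_k} is transitive). Then every quotient of G that is hereditarily just-infinite is virtually cyclic. -/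
/-- A group is residually finite if every nontrivial element avoids some
finite-index normal subgroup. -/
def ResiduallyFinite (G : Type*) [Group G] : Prop :=
  ∀ g : G, g ≠ 1 → ∃ N : Subgroup G, N.Normal ∧ N.FiniteIndex ∧ g ∉ N

/-- A group is just-infinite if it is infinite and every nontrivial normal
subgroup has finite index. -/
def JustInfinite (G : Type*) [Group G] : Prop :=
  Infinite G ∧ ∀ N : Subgroup G, N.Normal → N ≠ ⊥ → N.FiniteIndex

/-- A group is hereditarily just-infinite if it is residually finite and every
finite-index subgroup (including the group itself) is just-infinite. -/
def HereditarilyJustInfinite (G : Type*) [Group G] : Prop :=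
  ResiduallyFinite G ∧ ∀ H : Subgroup G, H.FiniteIndex → JustInfinite H

theorem hji_aux {Q : Type*} [Group Q] (hQ : HereditarilyJustInfinite Q) (K M : Subgroup Q)
    (hK : K.FiniteIndex) (hMK : M ≤ K) (hn : ∀ a ∈ K, ∀ m ∈ M, a * m * a⁻¹ ∈ M)
    (hM : M ≠ ⊥) : M.FiniteIndex := by
  have h1 : (M.subgroupOf K).FiniteIndex := by
    apply (hQ.2 K hK).2
    · constructor
      intro n hn' g
      rw [Subgroup.mem_subgroupOf] at hn' ⊢
      simpa using hn g g.2 n hn'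
    · intro h
      apply hM
      rw [Subgroup.subgroupOf_eq_bot] at h
      exact h.eq_bot_of_le hMK
  constructor
  rw [← Subgroup.relIndex_mul_index hMK]
  exact mul_ne_zero h1.index_ne_zero hK.index_ne_zero

/-- If a group `G` has a finite-index normal subgroup `H` which is the internal
direct product of `k ≥ 2` subgroups `L 0, …, L (k-1)`, normal in `H`, permuted
transitively by conjugation in `G`, then every hereditarily just-infinite quotient
of `G` is virtually cyclic. -/
theorem virtually_cyclic_of_hereditarily_just_infinite_quotient
    (G : Type*) [Group G] (H : Subgroup G) (hHnorm : H.Normal) (hHfi : H.FiniteIndex)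
    (k : ℕ) (hk : 2 ≤ k) (L : Fin k → Subgroup G)
    (hle : ∀ i, L i ≤ H)
    (hnormH : ∀ i, ∀ h ∈ H, ∀ x ∈ L i, h * x * h⁻¹ ∈ L i)
    (hcomm : ∀ i j, i ≠ j → ∀ x ∈ L i, ∀ y ∈ L j, Commute x y)
    (hiso : ∃ e : (∀ i, L i) ≃* H,
      ∀ x : ∀ i, L i, ((e x : H) : G) = (List.ofFn fun i => ((x i : G))).prod)
    (hconj : ∀ g : G, ∀ i, ∃ j, (L i).map (MulAut.conj g).toMonoidHom = L j)
    (htrans : ∀ i j, ∃ g : G, (L i).map (MulAut.conj g).toMonoidHom = L j) :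
    ∀ (N : Subgroup G) (_ : N.Normal), HereditarilyJustInfinite (G ⧸ N) →
      ∃ C : Subgroup (G ⧸ N), C.FiniteIndex ∧ IsCyclic C := by
  intro N hN hQ
  set f := QuotientGroup.mk' N with hf
  have hfs : Function.Surjective f := QuotientGroup.mk'_surjective N
  have hK : (H.map f).FiniteIndex := by
    constructor
    intro h0
    have := Subgroup.index_map_dvd H hfs
    rw [h0, zero_dvd_iff] at this
    exact hHfi.index_ne_zero this
  have hinf : ∀ A : Subgroup (G ⧸ N), A.FiniteIndex → A ≠ ⊥ := by
    rintro A hA rfl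
    have := (hQ.2 ⊥ hA).1
    exact not_finite (⊥ : Subgroup (G ⧸ N))
  have hne : ∀ i, (L i).map f ≠ ⊥ := by
    intro i hi
    rw [Subgroup.map_eq_bot_iff, hf, QuotientGroup.ker_mk'] at hi
    have hall : ∀ j, L j ≤ N := by
      intro j
      obtain ⟨g, hg⟩ := htrans i j
      rw [← hg]
      rintro _ ⟨x, hx, rfl⟩
      exact hN.conj_mem x (hi hx) g
    apply hinf _ hK
    rw [Subgroup.map_eq_bot_iff, hf, QuotientGroup.ker_mk']
    intro x hx
    obtain ⟨e, he⟩ := hiso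
    have h2 := he (e.symm ⟨x, hx⟩)
    rw [MulEquiv.apply_symm_apply] at h2
    change x = _ at h2
    rw [h2]
    apply Subgroup.list_prod_mem
    intro y hy
    rw [List.mem_ofFn] at hy
    obtain ⟨j, rfl⟩ := hy
    exact hall j (SetLike.coe_mem _)
  have hfi : ∀ i, ((L i).map f).FiniteIndex := by
    intro i
    refine hji_aux hQ (H.map f) _ hK (Subgroup.map_mono (hle i)) ?_ (hne i)
    rintro _ ⟨a, ha, rfl⟩ _ ⟨m, hm, rfl⟩
    exact ⟨a * m * a⁻¹, hnormH i a ha m hm, by simp⟩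
  let i0 : Fin k := ⟨0, by omega⟩
  let i1 : Fin k := ⟨1, by omega⟩
  have h01 : i0 ≠ i1 := by simp [i0, i1]
  have hA : ((L i0).map f ⊓ (L i1).map f).FiniteIndex := by
    have := hfi i0
    have := hfi i1
    infer_instance
  obtain ⟨⟨a, haA⟩, ha'⟩ := Subgroup.ne_bot_iff_exists_ne_one.1 (hinf _ hA)
  have ha : a ≠ 1 := fun h1 => ha' (Subtype.ext h1)
  refine ⟨Subgroup.zpowers a, ?_, inferInstance⟩
  refine hji_aux hQ _ _ hA (by simpa using haA) ?_ (by simpa using ha)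
  rintro b hb m hm
  have hmA : m ∈ (L i0).map f ⊓ (L i1).map f :=
    (Subgroup.zpowers_le.2 haA) hm
  obtain ⟨x, hx, rfl⟩ := hb.1
  obtain ⟨y, hy, rfl⟩ := hmA.2
  have hc : f x * f y = f y * f x := by
    rw [← map_mul, ← map_mul, (hcomm i0 i1 h01 x hx y hy).eq]
  rw [hc, mul_inv_cancel_right]
  exact hm
end

section
/- Let Γ be a nontrivial group in which every element has finite order equal to a power of 2, and let f be an automorphism of Γ with f ∘ f = id. Then f has a nontrivial fixed point: there exists g ∈ Γ with g ≠ 1 and f(g) = g. -/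
/-- An order-two automorphism of a nontrivial `2`-torsion group has a nontrivial
fixed point. -/
theorem exists_fixed_point_of_involution (Γ : Type*) [Group Γ] [Nontrivial Γ]
    (h2 : ∀ g : Γ, ∃ k : ℕ, orderOf g = 2 ^ k)
    (f : Γ ≃* Γ) (hf : ∀ g, f (f g) = g) :
    ∃ g : Γ, g ≠ 1 ∧ f g = g := by
  have key : ∀ g : Γ, g ≠ 1 → ∃ n : ℕ, g ^ n ≠ 1 ∧ g ^ n * g ^ n = 1 := by
    intro g hg
    obtain ⟨k, hk⟩ := h2 g
    cases k with
    | zero => exact absurd (orderOf_eq_one_iff.mp (by simpa using hk)) hg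
    | succ k =>
      refine ⟨2 ^ k, ?_, ?_⟩
      · intro h
        have h1 := orderOf_dvd_of_pow_eq_one h
        rw [hk] at h1
        have h3 := Nat.le_of_dvd (by positivity) h1
        have h4 : 0 < 2 ^ k := by positivity
        rw [pow_succ] at h3
        omega
      · rw [← pow_add, ← mul_two, ← pow_succ, ← hk, pow_orderOf_eq_one]
  obtain ⟨a, ha⟩ := exists_ne (1 : Γ)
  obtain ⟨m, hm1, hm2⟩ := key a ha
  generalize a ^ m = g at hm1 hm2
  by_cases hgh : g * f g = 1
  · refine ⟨g, hm1, ?_⟩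
    exact mul_left_cancel (hgh.trans hm2.symm)
  · obtain ⟨n, hn1, hn2⟩ := key _ hgh
    refine ⟨_, hn1, ?_⟩
    have hfg : f g * f g = 1 := by rw [← map_mul, hm2, map_one]
    have e : f (g * f g) = (g * f g)⁻¹ := by
      rw [map_mul, hf, mul_inv_rev, ← eq_inv_of_mul_eq_one_left hm2,
        ← eq_inv_of_mul_eq_one_left hfg]
    rw [map_pow, e, inv_pow]
    exact (eq_inv_of_mul_eq_one_left hn2).symm
end

section
/- Let Γ be a finitely generated residually finite group in which every element has finite order equal to a power of 2 and in which every subgroup is either finite or of finite index. Then Γ is finite. (Equivalently: there is no residually finite globally zero-one group which is 2-torsion.) -/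
theorem aux_avoid {Γ : Type*} [Group Γ]
    (hres : ∀ g : Γ, g ≠ 1 → ∃ N : Subgroup Γ, N.Normal ∧ N.FiniteIndex ∧ g ∉ N)
    (S : Set Γ) (hS : S.Finite) :
    ∃ N : Subgroup Γ, N.Normal ∧ N.FiniteIndex ∧ ∀ g ∈ S, g ∈ N → g = 1 := by
  induction S, hS using Set.Finite.induction_on with
  | empty => exact ⟨⊤, inferInstance, inferInstance, by simp⟩
  | @insert a s _ _ ih =>
    obtain ⟨N, h1, h2, h3⟩ := ih
    by_cases ha : a = 1
    · refine ⟨N, h1, h2, ?_⟩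
      rintro g (rfl | hg) hN
      · exact ha
      · exact h3 g hg hN
    · obtain ⟨M, m1, m2, m3⟩ := hres a ha
      refine ⟨N ⊓ M, inferInstance, inferInstance, ?_⟩
      rintro g (rfl | hg) hN
      · exact absurd hN.2 m3
      · exact h3 g hg hN.1

theorem aux_finite {Γ : Type*} [Group Γ] (N : Subgroup Γ) [N.FiniteIndex]
    (hN : (N : Set Γ).Finite) : Finite Γ := by
  have : Finite N := hN
  have h := N.card_mul_index
  have h1 : Nat.card N ≠ 0 := Nat.card_pos.ne'
  have h2 := Subgroup.FiniteIndex.index_ne_zero (H := N)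
  exact Nat.finite_of_card_ne_zero (by rw [← h]; exact mul_ne_zero h1 h2)

def auxFC (Γ : Type*) [Group Γ] : Subgroup Γ where
  carrier := {g | (Subgroup.centralizer {g}).FiniteIndex}
  one_mem' := by
    have : Subgroup.centralizer {(1 : Γ)} = ⊤ := by
      ext x; simp [Subgroup.mem_centralizer_iff]
    simp only [Set.mem_ofPred_eq, this]
    infer_instance
  mul_mem' := by
    intro a b ha hb
    simp only [Set.mem_ofPred_eq] at ha hb ⊢
    refine Subgroup.finiteIndex_of_le
      (H := Subgroup.centralizer {a} ⊓ Subgroup.centralizer {b}) ?_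
    rintro x hx
    obtain ⟨h1, h2⟩ := Subgroup.mem_inf.1 hx
    simp only [SetLike.mem_coe, Subgroup.mem_centralizer_iff, Set.mem_singleton_iff,
      forall_eq] at h1 h2 ⊢
    rw [mul_assoc, h2, ← mul_assoc, h1, mul_assoc]
  inv_mem' := by
    intro a ha
    simp only [Set.mem_ofPred_eq] at ha ⊢
    refine Subgroup.finiteIndex_of_le (H := Subgroup.centralizer {a}) ?_
    intro x h1
    simp only [Subgroup.mem_centralizer_iff, Set.mem_singleton_iff, forall_eq] at h1 ⊢
    exact (show Commute a x from h1).inv_left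

theorem aux_fc {Γ : Type*} [Group Γ] (hfg : Group.FG Γ)
    (ht : ∀ g : Γ, IsOfFinOrder g) (hF : (auxFC Γ).FiniteIndex) : Finite Γ := by
  have : Group.FG Γ := hfg
  have hFG : (auxFC Γ).FG := (Group.fg_iff_subgroup_fg _).1 inferInstance
  obtain ⟨S, hS⟩ := hFG
  have key : ∀ T : Finset Γ, (∀ t ∈ T, t ∈ auxFC Γ) →
      (Subgroup.centralizer (T : Set Γ)).FiniteIndex := by
    classical
    intro T
    induction T using Finset.induction_on with
    | empty =>
      intro _
      have : Subgroup.centralizer ((∅ : Finset Γ) : Set Γ) = ⊤ := by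
        ext x; simp [Subgroup.mem_centralizer_iff]
      rw [this]; infer_instance
    | insert a s _ ih =>
      intro h
      have i1 := ih (fun t ht => h t (Finset.mem_insert_of_mem ht))
      have i2 : (Subgroup.centralizer {a}).FiniteIndex := h a (Finset.mem_insert_self _ _)
      refine Subgroup.finiteIndex_of_le
        (H := Subgroup.centralizer {a} ⊓ Subgroup.centralizer (s : Set Γ)) ?_
      rintro x hx
      obtain ⟨h1, h2⟩ := Subgroup.mem_inf.1 hx
      simp only [SetLike.mem_coe, Subgroup.mem_centralizer_iff, Set.mem_singleton_iff,
        forall_eq] at h1 h2 ⊢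
      intro y hy
      rcases Finset.mem_insert.1 (Finset.mem_coe.1 hy) with rfl | hy
      · exact h1
      · exact h2 y hy
  have hZ := key S (fun t ht => hS ▸ Subgroup.subset_closure ht)
  have hZF : Subgroup.centralizer (S : Set Γ) ≤ Subgroup.centralizer (auxFC Γ : Set Γ) := by
    rw [← hS, Subgroup.centralizer_closure]
  have hZ' := Subgroup.finiteIndex_of_le hZF
  let A : Subgroup Γ := auxFC Γ ⊓ Subgroup.centralizer (auxFC Γ : Set Γ)
  have hA : A.FiniteIndex := inferInstanceAs (auxFC Γ ⊓ _ : Subgroup Γ).FiniteIndex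
  letI : CommGroup A := { (inferInstance : Group A) with
    mul_comm := fun a b => Subtype.ext
      (Subgroup.mem_centralizer_iff.1 b.2.2 a a.2.1) }
  have : Group.FG A := Subgroup.fg_of_index_ne_zero A
  have : Finite A := CommGroup.finite_of_fg_torsion A (fun a => by
    have := ht (a : Γ)
    exact Submonoid.isOfFinOrder_coe.1 this)
  exact aux_finite A (Set.toFinite _)

theorem aux_invol {Γ : Type*} [Group Γ] (h2 : ∀ g : Γ, ∃ k : ℕ, orderOf g = 2 ^ k)
    (g : Γ) (hg : g ≠ 1) : ∃ m : ℕ, g ^ m ≠ 1 ∧ g ^ m * g ^ m = 1 := by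
  obtain ⟨k, hk⟩ := h2 g
  cases k with
  | zero => exact absurd (orderOf_eq_one_iff.1 (by simpa using hk)) hg
  | succ k =>
    refine ⟨2 ^ k, ?_, ?_⟩
    · intro h
      have := orderOf_dvd_of_pow_eq_one h
      rw [hk] at this
      exact absurd (Nat.le_of_dvd (by positivity) this)
        (not_le.2 (Nat.pow_lt_pow_right (by norm_num) (Nat.lt_succ_self k)))
    · rw [← pow_add, ← two_mul, ← pow_succ', ← hk, pow_orderOf_eq_one]

/-- There is no residually finite globally zero-one group which is `2`-torsion:
a finitely generated residually finite `2`-torsion group in which every subgroup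
is finite or of finite index must be finite. -/
theorem finite_of_residually_finite_globally_zero_one_two_torsion
    (Γ : Type*) [Group Γ] (hfg : Group.FG Γ)
    (hres : ∀ g : Γ, g ≠ 1 → ∃ N : Subgroup Γ, N.Normal ∧ N.FiniteIndex ∧ g ∉ N)
    (h2 : ∀ g : Γ, ∃ k : ℕ, orderOf g = 2 ^ k)
    (hzo : ∀ H : Subgroup Γ, (H : Set Γ).Finite ∨ H.FiniteIndex) :
    Finite Γ := by
  have ht : ∀ g : Γ, IsOfFinOrder g := fun g => by
    obtain ⟨k, hk⟩ := h2 g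
    exact orderOf_pos_iff.1 (by rw [hk]; positivity)
  rcases hzo (auxFC Γ) with hF | hF
  swap
  · exact aux_fc hfg ht hF
  obtain ⟨N, _, hNi, hN⟩ := aux_avoid hres _ hF
  by_cases hb : ∃ g ∈ N, g ≠ 1
  swap
  · push Not at hb
    exact aux_finite N ((Set.finite_singleton (1 : Γ)).subset (fun g hg => hb g hg))
  obtain ⟨g, hgN, hg⟩ := hb
  obtain ⟨m, hm1, hm2⟩ := aux_invol h2 g hg
  have htN : g ^ m ∈ N := N.pow_mem hgN m
  generalize g ^ m = t at hm1 hm2 htN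
  rcases hzo (Subgroup.centralizer {t}) with hC | hC
  swap
  · exact absurd (hN t hC htN) hm1
  obtain ⟨M, hMn, hMi, hM⟩ := aux_avoid hres _ hC
  have hti : t⁻¹ = t := inv_eq_of_mul_eq_one_left hm2
  refine aux_finite M ((Set.finite_singleton (1 : Γ)).subset (fun n hn => ?_))
  have hn : n ∈ M := hn
  have hx : t * n⁻¹ * t⁻¹ * n ∈ M := M.mul_mem (hMn.conj_mem _ (M.inv_mem hn) t) hn
  have hinv : t * (t * n⁻¹ * t⁻¹ * n) * t⁻¹ = (t * n⁻¹ * t⁻¹ * n)⁻¹ := by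
    simp only [mul_inv_rev, inv_inv, hti, ← mul_assoc, hm2, one_mul]
  have hx1 : t * n⁻¹ * t⁻¹ * n = 1 := by
    by_contra hne
    obtain ⟨j, hj1, hj2⟩ := aux_invol h2 _ hne
    have hz : t * (t * n⁻¹ * t⁻¹ * n) ^ j * t⁻¹ = (t * n⁻¹ * t⁻¹ * n) ^ j := by
      rw [← conj_pow, hinv, inv_pow]
      exact inv_eq_of_mul_eq_one_left hj2
    refine hj1 (hM _ ?_ (M.pow_mem hx j))
    simp only [SetLike.mem_coe, Subgroup.mem_centralizer_iff, Set.mem_singleton_iff, forall_eq]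
    exact mul_inv_eq_iff_eq_mul.1 hz
  refine hM n ?_ hn
  simp only [SetLike.mem_coe, Subgroup.mem_centralizer_iff, Set.mem_singleton_iff, forall_eq]
  have h3 : t * n⁻¹ * t⁻¹ = n⁻¹ := eq_inv_of_mul_eq_one_left hx1
  have h4 : t * n * t⁻¹ = n := by
    have := congrArg (·⁻¹) h3
    simpa [mul_assoc] using this
  exact mul_inv_eq_iff_eq_mul.1 h4
end
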